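/- arXiv:1602.06901 — 2 statements merged into one kernel-verified Lean document; each statement's English description precedes it below -/
import Mathlib

section
/- Let F be a field of characteristic p. For α, γ ∈ F and β, δ ∈ F× with β + δ ≠ 0, there exists a symbol algebra C of degree p over F such that [α,β)_{p,F} ⊗ [γ,δ)_{p,F} ≅ [α+γ, β+δ)_{p,F} ⊗ C. -/
open scoped TensorProduct

/-- The defining relations of the symbol `p`-algebra
`[a,b)_{p,F} = F⟨x,y : x^p - x = a, y^p = b, yx - xy = y⟩`. -/
inductive SymbolRel (F : Type) [Field F] (p : ℕ) (a b : F) :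
    FreeAlgebra F (Fin 2) → FreeAlgebra F (Fin 2) → Prop
  | x : SymbolRel F p a b (FreeAlgebra.ι F 0 ^ p - FreeAlgebra.ι F 0) (algebraMap F _ a)
  | y : SymbolRel F p a b (FreeAlgebra.ι F 1 ^ p) (algebraMap F _ b)
  | comm : SymbolRel F p a b
      (FreeAlgebra.ι F 1 * FreeAlgebra.ι F 0 - FreeAlgebra.ι F 0 * FreeAlgebra.ι F 1)
      (FreeAlgebra.ι F 1)

/-- The symbol `p`-algebra `[a,b)_{p,F}`. -/
abbrev SymbolAlg (F : Type) [Field F] (p : ℕ) (a b : F) : Type :=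
  RingQuot (SymbolRel F p a b)

/-- Elements `x`, `y` satisfying the defining relations of `[a,b)_{p,F}`. -/
structure IsSymbolPair {F : Type} [Field F] (p : ℕ) (a b : F) {R : Type*} [Ring R] [Algebra F R]
    (x y : R) : Prop where
  pow_x : x ^ p - x = algebraMap F R a
  pow_y : y ^ p = algebraMap F R b
  comm : y * x - x * y = y

/-- Elements satisfying the defining relations of `[a,b)_{p,F} ⊗ [c,d)_{p,F}`. -/
structure IsBiSymbol {F : Type} [Field F] (p : ℕ) (a b c d : F) {R : Type*} [Ring R]
    [Algebra F R] (x y z w : R) : Prop where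
  left : IsSymbolPair p a b x y
  right : IsSymbolPair p c d z w
  comm_xz : Commute x z
  comm_xw : Commute x w
  comm_yz : Commute y z
  comm_yw : Commute y w

namespace SymbolAlg

variable {F : Type} [Field F] {p : ℕ} {a b : F}

/-- The `i`-th generator of `[a,b)_{p,F}`. -/
def gen (p : ℕ) (a b : F) (i : Fin 2) : SymbolAlg F p a b :=
  RingQuot.mkAlgHom F (SymbolRel F p a b) (FreeAlgebra.ι F i)

theorem isSymbolPair_gen : IsSymbolPair p a b (gen p a b 0) (gen p a b 1) where
  pow_x := by
    simpa [gen] using RingQuot.mkAlgHom_rel F (SymbolRel.x (F := F) (p := p) (a := a) (b := b))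
  pow_y := by
    simpa [gen] using RingQuot.mkAlgHom_rel F (SymbolRel.y (F := F) (p := p) (a := a) (b := b))
  comm := by
    simpa [gen] using RingQuot.mkAlgHom_rel F (SymbolRel.comm (F := F) (p := p) (a := a) (b := b))

theorem algHom_ext {R : Type*} [Semiring R] [Algebra F R] {f g : SymbolAlg F p a b →ₐ[F] R}
    (h : ∀ i, f (gen p a b i) = g (gen p a b i)) : f = g :=
  RingQuot.ringQuot_ext' F f g (FreeAlgebra.hom_ext (funext h))

theorem adjoin_gen : Algebra.adjoin F (Set.range (gen p a b)) = ⊤ := by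
  have : Set.range (gen p a b) = RingQuot.mkAlgHom F (SymbolRel F p a b) ''
      Set.range (FreeAlgebra.ι F) := by
    rw [← Set.range_comp]; rfl
  rw [this, ← AlgHom.map_adjoin, FreeAlgebra.adjoin_range_ι, Algebra.map_top,
    AlgHom.range_eq_top]
  exact RingQuot.mkAlgHom_surjective F _

/-- The homomorphism out of `[a,b)_{p,F}` given by elements satisfying its relations. -/
def lift {R : Type*} [Ring R] [Algebra F R] {x y : R} (h : IsSymbolPair p a b x y) :
    SymbolAlg F p a b →ₐ[F] R :=
  RingQuot.liftAlgHom F ⟨FreeAlgebra.lift F ![x, y], by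
    rintro _ _ (_ | _ | _)
    · simpa using h.pow_x
    · simpa using h.pow_y
    · simpa using h.comm⟩

theorem lift_gen {R : Type*} [Ring R] [Algebra F R] {x y : R} (h : IsSymbolPair p a b x y)
    (i : Fin 2) : lift h (gen p a b i) = ![x, y] i := by
  simp [lift, gen]

theorem commute_map {R : Type*} [Ring R] [Algebra F R] (f : SymbolAlg F p a b →ₐ[F] R) {r : R}
    (h : ∀ i, Commute (f (gen p a b i)) r) (s : SymbolAlg F p a b) : Commute (f s) r := by
  have hs : s ∈ Algebra.adjoin F (Set.range (gen p a b)) := by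
    rw [adjoin_gen]; exact Algebra.mem_top
  induction hs using Algebra.adjoin_induction with
  | mem s hs => obtain ⟨i, rfl⟩ := hs; exact h i
  | algebraMap c => rw [AlgHom.commutes]; exact Algebra.commutes c r
  | add s t _ _ hs ht => rw [map_add]; exact hs.add_left ht
  | mul s t _ _ hs ht => rw [map_mul]; exact hs.mul_left ht

end SymbolAlg

namespace IsBiSymbol

open SymbolAlg

variable {F : Type} [Field F] {p : ℕ} {a b c d : F} {R : Type*} [Ring R] [Algebra F R]
  {x y z w : R}

theorem tmul_gen (p : ℕ) (a b c d : F) :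
    IsBiSymbol p a b c d (R := SymbolAlg F p a b ⊗[F] SymbolAlg F p c d)
      (SymbolAlg.gen p a b 0 ⊗ₜ 1) (SymbolAlg.gen p a b 1 ⊗ₜ 1)
      (1 ⊗ₜ SymbolAlg.gen p c d 0) (1 ⊗ₜ SymbolAlg.gen p c d 1) where
  left :=
    { pow_x := by
        rw [Algebra.TensorProduct.tmul_pow, one_pow, ← TensorProduct.sub_tmul,
          isSymbolPair_gen.pow_x]; rfl
      pow_y := by
        rw [Algebra.TensorProduct.tmul_pow, one_pow, isSymbolPair_gen.pow_y]; rfl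
      comm := by
        simp only [Algebra.TensorProduct.tmul_mul_tmul, mul_one, ← TensorProduct.sub_tmul,
          isSymbolPair_gen.comm] }
  right :=
    { pow_x := by
        rw [Algebra.TensorProduct.tmul_pow, one_pow, ← TensorProduct.tmul_sub,
          isSymbolPair_gen.pow_x, ← Algebra.TensorProduct.algebraMap_apply']
      pow_y := by
        rw [Algebra.TensorProduct.tmul_pow, one_pow, isSymbolPair_gen.pow_y,
          ← Algebra.TensorProduct.algebraMap_apply']
      comm := by
        simp only [Algebra.TensorProduct.tmul_mul_tmul, mul_one, ← TensorProduct.tmul_sub,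
          isSymbolPair_gen.comm] }
  comm_xz := by simp [commute_iff_eq]
  comm_xw := by simp [commute_iff_eq]
  comm_yz := by simp [commute_iff_eq]
  comm_yw := by simp [commute_iff_eq]

/-- The homomorphism out of `[a,b)_{p,F} ⊗ [c,d)_{p,F}` given by elements satisfying its
relations. -/
noncomputable def lift (h : IsBiSymbol p a b c d x y z w) :
    SymbolAlg F p a b ⊗[F] SymbolAlg F p c d →ₐ[F] R :=
  Algebra.TensorProduct.lift (SymbolAlg.lift h.left) (SymbolAlg.lift h.right) fun s t =>
    commute_map _ (fun i => (commute_map _ (fun j => by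
      rw [lift_gen, lift_gen]
      fin_cases i <;> fin_cases j
      exacts [h.comm_xz.symm, h.comm_xw.symm, h.comm_yz.symm, h.comm_yw.symm]) t).symm) s

theorem lift_left (h : IsBiSymbol p a b c d x y z w) (i : Fin 2) :
    h.lift (SymbolAlg.gen p a b i ⊗ₜ 1) = ![x, y] i := by
  simp [lift, lift_gen]

theorem lift_right (h : IsBiSymbol p a b c d x y z w) (i : Fin 2) :
    h.lift (1 ⊗ₜ SymbolAlg.gen p c d i) = ![z, w] i := by
  simp [lift, lift_gen]

theorem algHom_ext {R : Type*} [Semiring R] [Algebra F R]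
    {f g : SymbolAlg F p a b ⊗[F] SymbolAlg F p c d →ₐ[F] R}
    (hl : ∀ i, f (SymbolAlg.gen p a b i ⊗ₜ 1) = g (SymbolAlg.gen p a b i ⊗ₜ 1))
    (hr : ∀ i, f (1 ⊗ₜ SymbolAlg.gen p c d i) = g (1 ⊗ₜ SymbolAlg.gen p c d i)) : f = g :=
  Algebra.TensorProduct.ext (SymbolAlg.algHom_ext hl) (SymbolAlg.algHom_ext hr)

end IsBiSymbol

open Polynomial in
theorem ascPochhammer_zmod_eq (p : ℕ) [Fact p.Prime] :
    ascPochhammer (ZMod p) p = X ^ p - X := by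
  have hp : 1 < p := (Fact.out : p.Prime).one_lt
  refine eq_of_degree_sub_lt_of_eval_finset_eq Finset.univ ?_ fun x _ => ?_
  · have hd : (ascPochhammer (ZMod p) p).degree = p := by
      rw [degree_eq_natDegree (monic_ascPochhammer _ _).ne_zero, ascPochhammer_natDegree]
    have hX : (X ^ p - X : (ZMod p)[X]).degree = p := by
      rw [degree_sub_eq_left_of_degree_lt] <;> simp [hp]
    have hm : (X ^ p - X : (ZMod p)[X]).Monic := monic_X_pow_sub (by simpa using hp)
    rw [Finset.card_univ, ZMod.card, ← hd]
    exact degree_sub_lt_left (hd.trans hX.symm) (monic_ascPochhammer _ _).ne_zero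
      ((monic_ascPochhammer _ _).leadingCoeff.trans hm.leadingCoeff.symm)
  · have := ascPochhammer_eval_neg_coe_nat_of_lt (R := ZMod p) (ZMod.val_lt (-x))
    rw [ZMod.natCast_zmod_val, neg_neg] at this
    simp [this]

open Polynomial in
theorem ascPochhammer_charP_eq (F : Type*) [Field F] (p : ℕ) [Fact p.Prime] [CharP F p] :
    ascPochhammer F p = X ^ p - X := by
  rw [← ascPochhammer_map (ZMod.castHom dvd_rfl F), ascPochhammer_zmod_eq]
  simp

section Algebra

variable {F : Type*} [Field F] {R : Type*} [Ring R] [Algebra F R]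

theorem aeval_ascPochhammer_succ (x : R) (n : ℕ) :
    Polynomial.aeval x (ascPochhammer F (n + 1)) =
      (x + n) * Polynomial.aeval x (ascPochhammer F n) := by
  rw [ascPochhammer_succ_right, mul_comm, map_mul, map_add, Polynomial.aeval_X, map_natCast]

theorem aeval_ascPochhammer_add_mul {x t u : R} (hxt : x * t - t * x = t * t - t)
    (hxu : Commute x u) (htu : Commute t u) (n : ℕ) :
    Polynomial.aeval (x + t * u) (ascPochhammer F n) =
      ∑ ij ∈ Finset.HasAntidiagonal.antidiagonal n, n.choose ij.1 •
        (t ^ ij.1 * Polynomial.aeval u (ascPochhammer F ij.1) *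
          Polynomial.aeval x (ascPochhammer F ij.2)) := by
  have hpow (k : ℕ) : x * t ^ k = t ^ k * x + k • (t ^ (k + 1) - t ^ k) := by
    induction k with
    | zero => simp
    | succ k ih =>
      rw [pow_succ, ← mul_assoc, ih]
      simp only [nsmul_eq_mul, pow_succ, Nat.cast_add, Nat.cast_one]
      linear_combination (norm := noncomm_ring) t ^ k * hxt
  have hcomm {v : R} (hv : Commute v u) (k : ℕ) :
      Commute v (Polynomial.aeval u (ascPochhammer F k)) := by
    induction k with
    | zero => simp
    | succ k ih =>
      rw [aeval_ascPochhammer_succ]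
      exact (hv.add_right (Nat.commute_cast v k)).mul_right ih
  induction n with
  | zero => simp
  | succ n ih =>
    rw [Finset.sum_antidiagonal_choose_succ_nsmul fun i j => t ^ i *
        Polynomial.aeval u (ascPochhammer F i) * Polynomial.aeval x (ascPochhammer F j),
      aeval_ascPochhammer_succ, ih, Finset.mul_sum, ← Finset.sum_add_distrib]
    refine Finset.sum_congr rfl fun ⟨i, j⟩ hij => ?_
    obtain rfl : i + j = n := Finset.HasAntidiagonal.mem_antidiagonal.1 hij
    simp only [aeval_ascPochhammer_succ]
    rw [Nat.choose_symm_add, ← smul_add, mul_smul_comm]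
    congr 1
    set e := Polynomial.aeval u (ascPochhammer F i)
    set f := Polynomial.aeval x (ascPochhammer F j)
    have h1 : x * e = e * x := hcomm hxu i
    have h3 : u * t ^ i = t ^ i * u := htu.symm.pow_right i
    have h4 := hpow i
    have h5 := (Nat.cast_commute i t).eq
    have h7 := (Nat.cast_commute j (t ^ i * e)).eq
    have h8 := (Nat.cast_commute i (t ^ i)).eq
    rw [nsmul_eq_mul] at h4
    rw [pow_succ'] at h4 ⊢
    push_cast
    linear_combination (norm := noncomm_ring) h4 * e * f + t ^ i * h1 * f + t * h3 * e * f
      + h7 * f + t * h8 * e * f + h5 * t ^ i * e * f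

theorem add_mul_pow_sub {p : ℕ} [Fact p.Prime] [CharP F p] {x t u : R}
    (hxt : x * t - t * x = t * t - t) (hxu : Commute x u) (htu : Commute t u) :
    (x + t * u) ^ p - (x + t * u) = x ^ p - x + t ^ p * (u ^ p - u) := by
  have hp : p.Prime := Fact.out
  have hc : (p : R) = 0 := by rw [← map_natCast (algebraMap F R), CharP.cast_eq_zero, map_zero]
  have key (v : R) : Polynomial.aeval v (ascPochhammer F p) = v ^ p - v := by
    simp [ascPochhammer_charP_eq]
  rw [← key, aeval_ascPochhammer_add_mul hxt hxu htu, ← key u, ← key x,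
    Finset.sum_eq_add (0, p) (p, 0) (by simp [hp.ne_zero])]
  · simp
  · rintro ⟨i, j⟩ hij ⟨h0, h1⟩
    rw [Finset.HasAntidiagonal.mem_antidiagonal] at hij
    obtain ⟨k, hk⟩ := hp.dvd_choose_self (k := i) (by grind) (by grind)
    simp [hk, hc]
  · simp
  · simp

variable (F) in
theorem Commute.add_pow_prime {p : ℕ} [Fact p.Prime] [CharP F p] {x y : R} (h : Commute x y) :
    (x + y) ^ p = x ^ p + y ^ p := by
  have hc : (p : R) = 0 := by rw [← map_natCast (algebraMap F R), CharP.cast_eq_zero, map_zero]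
  obtain ⟨r, hr⟩ := h.exists_add_pow_prime_eq (Fact.out : p.Prime)
  simpa [hc] using hr

variable (F) in
theorem Commute.sub_pow_prime {p : ℕ} [Fact p.Prime] [CharP F p] {x y : R} (h : Commute x y) :
    (x - y) ^ p = x ^ p - y ^ p := by
  have := (h.sub_left (Commute.refl y)).add_pow_prime (p := p) F
  rw [sub_add_cancel] at this
  rw [this, add_sub_cancel_right]

end Algebra

section Quot

variable {F : Type*} [Field F] {R S : Type*} [Ring R] [Algebra F R] [Ring S] [Algebra F S]

/-- The quotient `v / u` when `u ^ p` is the nonzero scalar `c`. -/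
def powQuot (p : ℕ) (c : F) (v u : R) : R :=
  c⁻¹ • (v * u ^ (p - 1))

theorem map_powQuot (f : R →ₐ[F] S) (p : ℕ) (c : F) (v u : R) :
    f (powQuot p c v u) = powQuot p c (f v) (f u) := by
  simp [powQuot]

variable {p : ℕ} {c : F} {u v : R}

theorem isUnit_of_pow_eq_algebraMap (hp : p ≠ 0) (hc : c ≠ 0) (hu : u ^ p = algebraMap F R c) :
    IsUnit u :=
  (isUnit_pow_iff hp).1 (hu ▸ hc.isUnit.map (algebraMap F R))

theorem powQuot_mul (hp : p ≠ 0) (hc : c ≠ 0) (hu : u ^ p = algebraMap F R c) :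
    powQuot p c v u * u = v := by
  rw [powQuot, smul_mul_assoc, mul_assoc, pow_sub_one_mul hp, hu, ← Algebra.commutes,
    ← Algebra.smul_def, smul_smul, inv_mul_cancel₀ hc, one_smul]

theorem commute_powQuot {s : R} (hv : Commute s v) (hu : Commute s u) :
    Commute s (powQuot p c v u) :=
  (hv.mul_right (hu.pow_right _)).smul_right _

theorem powQuot_pow (hp : p ≠ 0) (hc : c ≠ 0) (hu : u ^ p = algebraMap F R c) {d : F}
    (hv : v ^ p = algebraMap F R d) (h : Commute v u) :
    powQuot p c v u ^ p = algebraMap F R (d / c) := by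
  have hq : Commute (powQuot p c v u) u := (commute_powQuot h.symm (Commute.refl u)).symm
  have : powQuot p c v u ^ p * u ^ p = algebraMap F R (d / c) * u ^ p := by
    rw [← hq.mul_pow, powQuot_mul hp hc hu, hv, hu, ← map_mul, div_mul_cancel₀ _ hc]
  exact ((isUnit_of_pow_eq_algebraMap hp hc hu).pow p).mul_right_cancel this

theorem commutator_mul_of_mul_eq {t : R} (h : t * u = v) (x : R) :
    (t * x - x * t) * u = (v * x - x * v) - t * (u * x - x * u) := by
  linear_combination (norm := noncomm_ring) h * x - x * h

theorem powQuot_eq_of_mul_eq (hp : p ≠ 0) (hc : c ≠ 0) (hu : u ^ p = algebraMap F R c) {t : R}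
    (h : t * u = v) : powQuot p c v u = t :=
  (isUnit_of_pow_eq_algebraMap hp hc hu).mul_right_cancel ((powQuot_mul hp hc hu).trans h.symm)

end Quot

theorem one_add_div_ne_zero {F : Type*} [Field F] {β δ : F} (hδ : δ ≠ 0) (hβδ : β + δ ≠ 0) :
    1 + β / δ ≠ 0 := by
  rw [one_add_div hδ, add_comm]
  exact div_ne_zero hβδ hδ

namespace IsBiSymbol

variable {F : Type} [Field F] {p : ℕ} [Fact p.Prime] [CharP F p] {R : Type*} [Ring R]
  [Algebra F R] {α β γ δ : F}

section Add

variable {x₁ y₁ x₂ y₂ : R}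

theorem add_pow_y (h : IsBiSymbol p α β γ δ x₁ y₁ x₂ y₂) :
    (y₁ + y₂) ^ p = algebraMap F R (β + δ) := by
  rw [h.comm_yw.add_pow_prime F, h.left.pow_y, h.right.pow_y, map_add]

/-- Change of generators: with `t = y₁ / (y₁ + y₂)`, the elements `x₁ + x₂`, `y₁ + y₂` and
`x₁ - t (x₁ + x₂)`, `y₁ / y₂` generate two commuting symbol algebras. -/
theorem add (hδ : δ ≠ 0) (hβδ : β + δ ≠ 0) (h : IsBiSymbol p α β γ δ x₁ y₁ x₂ y₂) :
    IsBiSymbol p (α + γ) (β + δ) (α - β / (β + δ) * (α + γ)) (β / δ)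
      (x₁ + x₂) (y₁ + y₂) (x₁ - powQuot p (β + δ) y₁ (y₁ + y₂) * (x₁ + x₂))
      (powQuot p δ y₁ y₂) := by
  have hp : p ≠ 0 := (Fact.out : p.Prime).ne_zero
  have hY := h.add_pow_y
  have hyY : Commute y₁ (y₁ + y₂) := (Commute.refl y₁).add_right h.comm_yw
  have hyY' : Commute y₂ (y₁ + y₂) := h.comm_yw.symm.add_right (Commute.refl y₂)
  have hXpow : (x₁ + x₂) ^ p - (x₁ + x₂) = algebraMap F R (α + γ) := by
    rw [h.comm_xz.add_pow_prime F, map_add, ← h.left.pow_x, ← h.right.pow_x]; abel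
  have htpow := powQuot_pow hp hβδ hY h.left.pow_y hyY
  have htY := powQuot_mul (v := y₁) hp hβδ hY
  have hYt : Commute (powQuot p (β + δ) y₁ (y₁ + y₂)) (y₁ + y₂) :=
    (commute_powQuot hyY.symm (Commute.refl _)).symm
  have hyt : Commute (powQuot p (β + δ) y₁ (y₁ + y₂)) y₁ :=
    (commute_powQuot (Commute.refl _) hyY).symm
  have hyt' : Commute (powQuot p (β + δ) y₁ (y₁ + y₂)) y₂ :=
    (commute_powQuot h.comm_yw.symm hyY').symm
  have hzt := commute_powQuot (p := p) (c := δ) hyt hyt'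
  have hzY := commute_powQuot (p := p) (c := δ) hyY.symm hyY'.symm
  have hzy := powQuot_mul (v := y₁) hp hδ h.right.pow_y
  have hzpow := powQuot_pow hp hδ h.right.pow_y h.left.pow_y h.comm_yw
  have huY := isUnit_of_pow_eq_algebraMap hp hβδ hY
  have huy := isUnit_of_pow_eq_algebraMap hp hδ h.right.pow_y
  set t := powQuot p (β + δ) y₁ (y₁ + y₂)
  set z := powQuot p δ y₁ y₂
  have e1 := h.left.comm
  have e2 := h.right.comm
  have e3 : x₁ * y₂ = y₂ * x₁ := h.comm_xw
  have e4 : y₁ * x₂ = x₂ * y₁ := h.comm_yz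
  have hxX : Commute x₁ (x₁ + x₂) := (Commute.refl x₁).add_right h.comm_xz
  have hYX : (y₁ + y₂) * (x₁ + x₂) - (x₁ + x₂) * (y₁ + y₂) = y₁ + y₂ := by
    linear_combination (norm := noncomm_ring) e1 + e2 - e3 + e4
  have hyX : y₁ * (x₁ + x₂) - (x₁ + x₂) * y₁ = y₁ := by
    linear_combination (norm := noncomm_ring) e1 + e4
  have hyX' : y₂ * (x₁ + x₂) - (x₁ + x₂) * y₂ = y₂ := by
    linear_combination (norm := noncomm_ring) e2 - e3
  have hYx : (y₁ + y₂) * x₁ - x₁ * (y₁ + y₂) = y₁ := by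
    linear_combination (norm := noncomm_ring) e1 - e3
  have hxt : x₁ * t - t * x₁ = t * t - t := huY.mul_right_cancel <| by
    rw [← neg_sub, neg_mul, commutator_mul_of_mul_eq htY, e1, hYx, sub_mul, mul_assoc, htY,
      neg_sub]
  have htX : Commute t (x₁ + x₂) := sub_eq_zero.1 <| huY.mul_right_cancel <| by
    rw [commutator_mul_of_mul_eq htY, hyX, hYX, htY, sub_self, zero_mul]
  have hzX : Commute z (x₁ + x₂) := sub_eq_zero.1 <| huy.mul_right_cancel <| by
    rw [commutator_mul_of_mul_eq hzy, hyX, hyX', hzy, sub_self, zero_mul]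
  have hzx : z * x₁ - x₁ * z = z := huy.mul_right_cancel <| by
    rw [commutator_mul_of_mul_eq hzy, e1, e3, sub_self, mul_zero, sub_zero, hzy]
  refine ⟨⟨hXpow, hY, hYX⟩, ⟨?_, hzpow, ?_⟩, ?_, hzX.symm, ?_, hzY⟩
  · have hpow := add_mul_pow_sub (F := F) (p := p) hxt hxX.neg_right htX.neg_right
    have hneg : (-(x₁ + x₂)) ^ p = -(x₁ + x₂) ^ p := by
      simpa [hp] using (Commute.zero_left (x₁ + x₂)).sub_pow_prime (p := p) F
    rw [mul_neg, ← sub_eq_add_neg] at hpow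
    rw [hpow, hneg, ← neg_sub', hXpow, h.left.pow_x, htpow, ← map_neg, ← map_mul, ← map_add]
    congr 1
    ring
  · rw [mul_sub, sub_mul, sub_sub_sub_comm, hzx, ← mul_assoc, ← hzt.eq, mul_assoc, hzX.eq,
      ← mul_assoc, sub_self, sub_zero]
  · exact hxX.symm.sub_right (htX.symm.mul_right (Commute.refl _))
  · refine sub_eq_zero.1 ?_
    rw [mul_sub, sub_mul, sub_sub_sub_comm, hYx, ← mul_assoc, ← hYt.eq, mul_assoc, mul_assoc,
      ← mul_sub, hYX, htY, sub_self]

theorem powQuot_powQuot (hδ : δ ≠ 0) (hβδ : β + δ ≠ 0) (h : IsBiSymbol p α β γ δ x₁ y₁ x₂ y₂) :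
    powQuot p (1 + β / δ) (powQuot p δ y₁ y₂) (1 + powQuot p δ y₁ y₂) =
      powQuot p (β + δ) y₁ (y₁ + y₂) := by
  have hp : p ≠ 0 := (Fact.out : p.Prime).ne_zero
  have hzpow := (h.add hδ hβδ).right.pow_y
  have hzy := powQuot_mul (v := y₁) hp hδ h.right.pow_y
  have htY := powQuot_mul (v := y₁) hp hβδ h.add_pow_y
  refine powQuot_eq_of_mul_eq hp (one_add_div_ne_zero hδ hβδ) ?_ ?_
  · rw [(Commute.one_left _).add_pow_prime F, one_pow, hzpow, map_add, map_one]
  · refine (isUnit_of_pow_eq_algebraMap hp hδ h.right.pow_y).mul_right_cancel ?_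
    rw [mul_assoc, add_mul, one_mul, hzy, add_comm y₂, htY]

end Add

section Sub

variable {X Y w z : R}

/-- The inverse change of generators, where `y₁ / (y₁ + y₂)` is recovered as `z / (1 + z)`. -/
theorem sub (hδ : δ ≠ 0) (hβδ : β + δ ≠ 0)
    (h : IsBiSymbol p (α + γ) (β + δ) (α - β / (β + δ) * (α + γ)) (β / δ) X Y w z) :
    IsBiSymbol p α β γ δ (w + powQuot p (1 + β / δ) z (1 + z) * X)
      (powQuot p (1 + β / δ) z (1 + z) * Y)
      (X - (w + powQuot p (1 + β / δ) z (1 + z) * X))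
      (Y - powQuot p (1 + β / δ) z (1 + z) * Y) := by
  have hp : p ≠ 0 := (Fact.out : p.Prime).ne_zero
  have hc := one_add_div_ne_zero hδ hβδ
  have hz : (1 + z) ^ p = algebraMap F R (1 + β / δ) := by
    rw [(Commute.one_left z).add_pow_prime F, one_pow, h.right.pow_y, map_add, map_one]
  have hzz : Commute z (1 + z) := (Commute.one_right z).add_right (Commute.refl z)
  have htz := powQuot_mul (v := z) hp hc hz
  have htpow := powQuot_pow hp hc hz h.right.pow_y hzz
  have hXt := commute_powQuot (p := p) (c := 1 + β / δ) h.comm_xw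
    ((Commute.one_right X).add_right h.comm_xw)
  have hYt := commute_powQuot (p := p) (c := 1 + β / δ) h.comm_yw
    ((Commute.one_right Y).add_right h.comm_yw)
  have huz := isUnit_of_pow_eq_algebraMap hp hc hz
  set t := powQuot p (1 + β / δ) z (1 + z)
  have htc : β / δ / (1 + β / δ) = β / (β + δ) := by
    rw [one_add_div hδ, div_div_div_cancel_right₀ hδ, add_comm]
  rw [htc] at htpow
  have hzw : (1 + z) * w - w * (1 + z) = z := by
    rw [add_mul, mul_add, one_mul, mul_one, add_sub_add_left_eq_sub, h.right.comm]
  have hwt : w * t - t * w = t * t - t := huz.mul_right_cancel <| by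
    rw [← neg_sub, neg_mul, commutator_mul_of_mul_eq htz, h.right.comm, hzw, sub_mul, mul_assoc,
      htz, neg_sub]
  have hXx : Commute X (w + t * X) :=
    h.comm_xz.add_right (hXt.mul_right (Commute.refl X))
  have hyY : Commute (t * Y) Y := hYt.symm.mul_left (Commute.refl Y)
  have hxpow : (w + t * X) ^ p - (w + t * X) = algebraMap F R α := by
    rw [add_mul_pow_sub (F := F) hwt h.comm_xz.symm hXt.symm, h.right.pow_x, h.left.pow_x, htpow,
      ← map_mul, ← map_add, sub_add_cancel]
  have hypow : (t * Y) ^ p = algebraMap F R β := by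
    rw [hYt.symm.mul_pow, htpow, h.left.pow_y, ← map_mul, div_mul_cancel₀ _ hβδ]
  have hYx : Y * (w + t * X) - (w + t * X) * Y = t * Y := by
    rw [mul_add, add_mul, h.comm_yz.eq, add_sub_add_left_eq_sub, ← mul_assoc, hYt.eq, mul_assoc,
      mul_assoc, ← mul_sub, h.left.comm]
  have hyx : t * Y * (w + t * X) - (w + t * X) * (t * Y) = t * Y := by
    linear_combination (norm := noncomm_ring) t * hYx - hwt * Y - t * hXt.eq * Y
  have hyX : t * Y * X - X * (t * Y) = t * Y := by
    rw [← mul_assoc X, hXt.eq, mul_assoc, mul_assoc, ← mul_sub, h.left.comm]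
  refine ⟨⟨hxpow, hypow, hyx⟩, ⟨?_, ?_, ?_⟩, ?_, ?_, ?_, ?_⟩
  · rw [hXx.sub_pow_prime F, sub_sub_sub_comm, h.left.pow_x, hxpow, ← map_sub,
      add_sub_cancel_left]
  · rw [hyY.symm.sub_pow_prime F, h.left.pow_y, hypow, ← map_sub, add_sub_cancel_left]
  · linear_combination (norm := noncomm_ring) h.left.comm - hYx - hyX + hyx
  · exact hXx.symm.sub_right (Commute.refl _)
  · change _ * _ = _ * _
    linear_combination (norm := noncomm_ring) hyx - hYx
  · change _ * _ = _ * _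
    linear_combination (norm := noncomm_ring) hyX - hyx
  · exact hyY.sub_right (Commute.refl _)

theorem powQuot_mul_sub (hδ : δ ≠ 0) (hβδ : β + δ ≠ 0)
    (h : IsBiSymbol p (α + γ) (β + δ) (α - β / (β + δ) * (α + γ)) (β / δ) X Y w z) :
    powQuot p δ (powQuot p (1 + β / δ) z (1 + z) * Y)
      (Y - powQuot p (1 + β / δ) z (1 + z) * Y) = z := by
  have hp : p ≠ 0 := (Fact.out : p.Prime).ne_zero
  have hz : (1 + z) ^ p = algebraMap F R (1 + β / δ) := by
    rw [(Commute.one_left z).add_pow_prime F, one_pow, h.right.pow_y, map_add, map_one]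
  have htz := powQuot_mul (v := z) hp (one_add_div_ne_zero hδ hβδ) hz
  have hzt := commute_powQuot (p := p) (c := 1 + β / δ) (Commute.refl z)
    ((Commute.one_right z).add_right (Commute.refl z))
  refine powQuot_eq_of_mul_eq hp hδ (h.sub hδ hβδ).right.pow_y ?_
  rw [mul_sub, ← mul_assoc, hzt.eq, ← sub_mul]
  congr 1
  linear_combination (norm := noncomm_ring) -htz

end Sub

section Inverse

variable {S : Type*} [Ring S] [Algebra F S] {x₁ y₁ x₂ y₂ : R} {X Y w z : S}
  {f : R →ₐ[F] S} {g : S →ₐ[F] R}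

theorem map_map_eq (hδ : δ ≠ 0) (hβδ : β + δ ≠ 0) (h : IsBiSymbol p α β γ δ x₁ y₁ x₂ y₂)
    (h' : IsBiSymbol p (α + γ) (β + δ) (α - β / (β + δ) * (α + γ)) (β / δ) X Y w z)
    (hX : g X = x₁ + x₂) (hY : g Y = y₁ + y₂)
    (hw : g w = x₁ - powQuot p (β + δ) y₁ (y₁ + y₂) * (x₁ + x₂))
    (hz : g z = powQuot p δ y₁ y₂) (hx₁ : f x₁ = w + powQuot p (1 + β / δ) z (1 + z) * X)
    (hy₁ : f y₁ = powQuot p (1 + β / δ) z (1 + z) * Y) (hx₂ : f x₂ = X - f x₁)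
    (hy₂ : f y₂ = Y - f y₁) :
    (f (g X) = X ∧ f (g Y) = Y ∧ f (g w) = w ∧ f (g z) = z) ∧
      g (f x₁) = x₁ ∧ g (f y₁) = y₁ ∧ g (f x₂) = x₂ ∧ g (f y₂) = y₂ := by
  have hp : p ≠ 0 := (Fact.out : p.Prime).ne_zero
  constructor
  · have hfX : f (g X) = X := by rw [hX, map_add, hx₂, add_sub_cancel]
    have hfY : f (g Y) = Y := by rw [hY, map_add, hy₂, add_sub_cancel]
    refine ⟨hfX, hfY, ?_, ?_⟩
    · rw [hw, map_sub, map_mul, map_powQuot, ← hX, ← hY, hfX, hfY, hy₁,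
        powQuot_eq_of_mul_eq hp hβδ h'.left.pow_y rfl, hx₁, add_sub_cancel_right]
    · rw [hz, map_powQuot, hy₂, hy₁, h'.powQuot_mul_sub hδ hβδ]
  · have ht : g (powQuot p (1 + β / δ) z (1 + z)) = powQuot p (β + δ) y₁ (y₁ + y₂) := by
      rw [map_powQuot, map_add, map_one, hz, h.powQuot_powQuot hδ hβδ]
    have hgx : g (f x₁) = x₁ := by rw [hx₁, map_add, map_mul, ht, hw, hX, sub_add_cancel]
    have hgy : g (f y₁) = y₁ := by rw [hy₁, map_mul, ht, hY, powQuot_mul hp hβδ h.add_pow_y]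
    exact ⟨hgx, hgy, by rw [hx₂, map_sub, hgx, hX, add_sub_cancel_left],
      by rw [hy₂, map_sub, hgy, hY, add_sub_cancel_left]⟩

end Inverse

end IsBiSymbol

/-- If `β + δ ≠ 0` then `[α,β) ⊗ [γ,δ) ≅ [α+γ, β+δ) ⊗ C` for some symbol algebra `C`
of degree `p`. -/
theorem symbol_tensor_add (p : ℕ) (hp : p.Prime) (F : Type) [Field F] [CharP F p]
    (α γ β δ : F) (hβ : β ≠ 0) (hδ : δ ≠ 0) (hβδ : β + δ ≠ 0) :
    ∃ (a b : F), b ≠ 0 ∧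
      Nonempty ((SymbolAlg F p α β ⊗[F] SymbolAlg F p γ δ) ≃ₐ[F]
        (SymbolAlg F p (α + γ) (β + δ) ⊗[F] SymbolAlg F p a b)) := by
  have : Fact p.Prime := ⟨hp⟩
  have hA := IsBiSymbol.tmul_gen p α β γ δ
  have hB := IsBiSymbol.tmul_gen p (α + γ) (β + δ) (α - β / (β + δ) * (α + γ)) (β / δ)
  have hf := hB.sub hδ hβδ
  have hg := hA.add hδ hβδ
  obtain ⟨⟨hX, hY, hw, hz⟩, hx₁, hy₁, hx₂, hy₂⟩ :=
    hA.map_map_eq (f := hf.lift) (g := hg.lift) hδ hβδ hB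
      (hg.lift_left 0) (hg.lift_left 1) (hg.lift_right 0) (hg.lift_right 1)
      (hf.lift_left 0) (hf.lift_left 1)
      (by rw [hf.lift_right, hf.lift_left]; rfl) (by rw [hf.lift_right, hf.lift_left]; rfl)
  refine ⟨α - β / (β + δ) * (α + γ), β / δ, div_ne_zero hβ hδ,
    ⟨AlgEquiv.ofAlgHom hf.lift hg.lift (IsBiSymbol.algHom_ext ?_ ?_)
      (IsBiSymbol.algHom_ext ?_ ?_)⟩⟩ <;> refine Fin.forall_fin_two.2 ⟨?_, ?_⟩
  exacts [hX, hY, hw, hz, hx₁, hy₁, hx₂, hy₂]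
end

section
/- Let F be a field of characteristic p and α, β ∈ F with β ≠ 0. Then [α,β)_{p,F} ⊗ [α,γ)_{p,F} ≅ M_p(F) ⊗ [α, βγ)_{p,F} for any γ ∈ F×. -/
open scoped TensorProduct

/-- The pair `x, y` satisfies the defining relations of `[a,b)_{p,F}`. -/
structure IsSymbolPair_s8 {F A : Type} [Field F] [Ring A] [Algebra F A] (p : ℕ) (a b : F)
    (x y : A) : Prop where
  pow_sub : x ^ p - x = algebraMap F A a
  pow_eq : y ^ p = algebraMap F A b
  comm : y * x - x * y = y

namespace IsSymbolPair_s8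

variable {F A : Type} [Field F] [Ring A] [Algebra F A] {p : ℕ} {a b : F} {x y : A}

theorem mul_eq (h : IsSymbolPair_s8 p a b x y) : y * x = (x + 1) * y := by
  rw [add_mul, one_mul, ← sub_eq_iff_eq_add']
  exact h.comm

theorem map {B : Type} [Ring B] [Algebra F B] (h : IsSymbolPair_s8 p a b x y) (f : A →ₐ[F] B) :
    IsSymbolPair_s8 p a b (f x) (f y) where
  pow_sub := by rw [← map_pow, ← map_sub, h.pow_sub, AlgHom.commutes]
  pow_eq := by rw [← map_pow, h.pow_eq, AlgHom.commutes]
  comm := by rw [← map_mul, ← map_mul, ← map_sub, h.comm]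

end IsSymbolPair_s8

/-- The algebra `[a,b)_{p,F}` with its ring structure as the primary one, so that tensor products
of such algebras are seen to be rings. -/
def SymbolRing (F : Type) [Field F] (p : ℕ) (a b : F) : Type := SymbolAlg F p a b

namespace SymbolRing

noncomputable instance (F : Type) [Field F] (p : ℕ) (a b : F) : Ring (SymbolRing F p a b) :=
  inferInstanceAs (Ring (RingQuot (SymbolRel F p a b)))

noncomputable instance (F : Type) [Field F] (p : ℕ) (a b : F) : Algebra F (SymbolRing F p a b) :=
  { (RingQuot.instAlgebra (SymbolRel F p a b) : Algebra F (RingQuot (SymbolRel F p a b))) with }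

/-- The identity map between the two descriptions of `[a,b)_{p,F}`. -/
noncomputable def equiv (F : Type) [Field F] (p : ℕ) (a b : F) :
    SymbolRing F p a b ≃ₐ[F] SymbolAlg F p a b where
  toEquiv := Equiv.refl _
  map_mul' _ _ := rfl
  map_add' _ _ := rfl
  commutes' _ := rfl

variable {F : Type} [Field F] {p : ℕ} {a b : F}

variable (F p a b) in
/-- The quotient map from the free algebra onto `[a,b)_{p,F}`. -/
noncomputable def mk : FreeAlgebra F (Fin 2) →ₐ[F] SymbolRing F p a b :=
  (equiv F p a b).symm.toAlgHom.comp (RingQuot.mkAlgHom F (SymbolRel F p a b))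

theorem mk_rel {s t : FreeAlgebra F (Fin 2)} (h : SymbolRel F p a b s t) :
    mk F p a b s = mk F p a b t :=
  congrArg (equiv F p a b).symm (RingQuot.mkAlgHom_rel F h)

variable (F p a b) in
theorem mk_surjective : Function.Surjective (mk F p a b) :=
  (equiv F p a b).symm.surjective.comp (RingQuot.mkAlgHom_surjective F _)

variable (F p a b) in
/-- The generator `x` of `[a,b)_{p,F}`. -/
noncomputable def genX : SymbolRing F p a b := mk F p a b (FreeAlgebra.ι F 0)

variable (F p a b) in
/-- The generator `y` of `[a,b)_{p,F}`. -/
noncomputable def genY : SymbolRing F p a b := mk F p a b (FreeAlgebra.ι F 1)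

variable (F p a b) in
theorem isSymbolPair_gen : IsSymbolPair_s8 p a b (genX F p a b) (genY F p a b) where
  pow_sub := by simpa [genX] using mk_rel (SymbolRel.x (F := F) (p := p) (a := a) (b := b))
  pow_eq := by simpa [genY] using mk_rel (SymbolRel.y (F := F) (p := p) (a := a) (b := b))
  comm := by
    simpa [genX, genY] using mk_rel (SymbolRel.comm (F := F) (p := p) (a := a) (b := b))

/-- The universal property of `[a,b)_{p,F}`. -/
noncomputable def lift {A : Type} [Ring A] [Algebra F A] {x y : A} (h : IsSymbolPair_s8 p a b x y) :
    SymbolRing F p a b →ₐ[F] A :=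
  (RingQuot.liftAlgHom F ⟨FreeAlgebra.lift F ![x, y], by
    rintro _ _ (_ | _ | _)
    · simpa using h.pow_sub
    · simpa using h.pow_eq
    · simpa using h.comm⟩).comp (equiv F p a b).toAlgHom

section Lift

variable {A : Type} [Ring A] [Algebra F A] {x y : A}

@[simp]
theorem lift_genX (h : IsSymbolPair_s8 p a b x y) : lift h (genX F p a b) = x := by
  simp [lift, genX, mk]

@[simp]
theorem lift_genY (h : IsSymbolPair_s8 p a b x y) : lift h (genY F p a b) = y := by
  simp [lift, genY, mk]

theorem hom_ext {f g : SymbolRing F p a b →ₐ[F] A} (hX : f (genX F p a b) = g (genX F p a b))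
    (hY : f (genY F p a b) = g (genY F p a b)) : f = g := by
  have h : f.comp (mk F p a b) = g.comp (mk F p a b) := by
    apply FreeAlgebra.hom_ext
    funext i
    fin_cases i
    · exact hX
    · exact hY
  exact (AlgHom.cancel_right (mk_surjective F p a b)).mp h

end Lift

theorem induction {C : SymbolRing F p a b → Prop} (algebraMap : ∀ r, C (algebraMap F _ r))
    (genX : C (genX F p a b)) (genY : C (genY F p a b))
    (mul : ∀ s t, C s → C t → C (s * t)) (add : ∀ s t, C s → C t → C (s + t))
    (s : SymbolRing F p a b) : C s := by
  obtain ⟨s, rfl⟩ := mk_surjective F p a b s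
  induction s using FreeAlgebra.induction with
  | grade0 r => simpa using algebraMap r
  | grade1 i =>
    fin_cases i
    · exact genX
    · exact genY
  | mul s t hs ht => simpa using mul _ _ hs ht
  | add s t hs ht => simpa using add _ _ hs ht

theorem commute_of_gen {A : Type} [Ring A] [Algebra F A] {f : SymbolRing F p a b →ₐ[F] A} {t : A}
    (hX : Commute (f (genX F p a b)) t) (hY : Commute (f (genY F p a b)) t)
    (s : SymbolRing F p a b) : Commute (f s) t := by
  induction s using SymbolRing.induction with
  | algebraMap r => rw [AlgHom.commutes]; exact Algebra.commutes r t
  | genX => exact hX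
  | genY => exact hY
  | mul s s' hs hs' => rw [map_mul]; exact hs.mul_left hs'
  | add s s' hs hs' => rw [map_add]; exact hs.add_left hs'

/-- The monomials `x ^ i * y ^ j` with `i, j < p` span `[a,b)_{p,F}`. -/
theorem span_monomials_eq_top (hp : 1 < p) :
    Submodule.span F (Set.range fun ij : Fin p × Fin p =>
      genX F p a b ^ (ij.1 : ℕ) * genY F p a b ^ (ij.2 : ℕ)) = ⊤ := by
  set M := Submodule.span F (Set.range fun ij : Fin p × Fin p =>
      genX F p a b ^ (ij.1 : ℕ) * genY F p a b ^ (ij.2 : ℕ)) with hM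
  have h := isSymbolPair_gen F p a b
  have hlt (i j : ℕ) (hj : j < p) : genX F p a b ^ i * genY F p a b ^ j ∈ M := by
    induction i using Nat.strong_induction_on with
    | _ i ih =>
      by_cases hi : i < p
      · exact Submodule.subset_span ⟨(⟨i, hi⟩, ⟨j, hj⟩), rfl⟩
      · obtain ⟨k, rfl⟩ := Nat.exists_eq_add_of_le (not_lt.mp hi)
        rw [add_comm, pow_add, sub_eq_iff_eq_add.mp h.pow_sub, mul_add, add_mul, ← pow_succ,
          ← Algebra.commutes, mul_assoc, ← Algebra.smul_def]
        exact M.add_mem (M.smul_mem _ (ih k (by omega))) (ih (k + 1) (by omega))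
  have hmem (i j : ℕ) : genX F p a b ^ i * genY F p a b ^ j ∈ M := by
    rw [← Nat.mod_add_div j p, pow_add, pow_mul, h.pow_eq, ← map_pow, ← Algebra.commutes,
      ← mul_assoc, ← Algebra.commutes, mul_assoc, ← Algebra.smul_def]
    exact M.smul_mem _ (hlt _ _ (Nat.mod_lt _ (by omega)))
  have hmul (s : SymbolRing F p a b) : ∀ m ∈ M, s * m ∈ M := by
    induction s using SymbolRing.induction with
    | algebraMap r => intro m hm; rw [← Algebra.smul_def]; exact M.smul_mem _ hm
    | genX =>
      intro m hm
      induction hm using Submodule.span_induction with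
      | mem m hm =>
        obtain ⟨ij, rfl⟩ := hm
        rw [← mul_assoc, ← pow_succ']
        exact hmem _ _
      | zero => simp
      | add m m' _ _ hm hm' => rw [mul_add]; exact M.add_mem hm hm'
      | smul r m _ hm => rw [mul_smul_comm]; exact M.smul_mem _ hm
    | genY =>
      intro m hm
      induction hm using Submodule.span_induction with
      | mem m hm =>
        obtain ⟨ij, rfl⟩ := hm
        have hs : SemiconjBy (genY F p a b) (genX F p a b) (genX F p a b + 1) := h.mul_eq
        rw [← mul_assoc, (hs.pow_right _).eq, mul_assoc, ← pow_succ', (Commute.one_right _).add_pow,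
          Finset.sum_mul]
        refine M.sum_mem fun k _ => ?_
        rw [one_pow, mul_one, mul_assoc, (Nat.commute_cast _ _).left_comm, ← nsmul_eq_mul]
        exact M.nsmul_mem (hmem _ _) _
      | zero => simp
      | add m m' _ _ hm hm' => rw [mul_add]; exact M.add_mem hm hm'
      | smul r m _ hm => rw [mul_smul_comm]; exact M.smul_mem _ hm
    | mul s t hs ht => intro m hm; rw [mul_assoc]; exact hs _ (ht _ hm)
    | add s t hs ht => intro m hm; rw [add_mul]; exact M.add_mem (hs _ hm) (ht _ hm)
  refine eq_top_iff.mpr fun s _ => ?_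
  simpa using hmul s 1 (by simpa using hmem 0 0)

end SymbolRing

/-- The sequences `f` with `f (n + p) = c * f n`. -/
def quasiPeriodic (F : Type) [Field F] (p : ℕ) (c : F) : Submodule F (ℕ → F) where
  carrier := {f | ∀ n, f (n + p) = c * f n}
  add_mem' hf hg n := by simp [hf n, hg n, mul_add]
  zero_mem' n := by simp
  smul_mem' r f hf n := by simp [hf n, mul_left_comm]

namespace quasiPeriodic

variable {F : Type} [Field F] {p : ℕ} {c : F}

theorem apply_add_mul (f : quasiPeriodic F p c) (n k : ℕ) :
    (f : ℕ → F) (n + p * k) = c ^ k * (f : ℕ → F) n := by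
  induction k with
  | zero => simp
  | succ k ih => rw [mul_add, mul_one, ← add_assoc, f.2, ih, pow_succ']; ring

variable (F p c) in
/-- A quasi-periodic sequence is determined by its first `p` terms, which are arbitrary. -/
def equivFun [NeZero p] : quasiPeriodic F p c ≃ₗ[F] (Fin p → F) where
  toFun f i := (f : ℕ → F) i
  map_add' _ _ := rfl
  map_smul' _ _ := rfl
  invFun g := ⟨fun n => c ^ (n / p) * g (Fin.ofNat p n), fun n => by
    have hp : 0 < p := Nat.pos_of_neZero p
    simp only [Nat.add_div_right n hp, Fin.ofNat, Nat.add_mod_right, pow_succ']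
    ring⟩
  left_inv f := by
    ext n
    conv_rhs => rw [← Nat.mod_add_div n p, apply_add_mul]
    rfl
  right_inv g := by
    ext i
    simp [Nat.div_eq_of_lt i.2]

variable (F p c) in
/-- The operator `f ↦ (n ↦ n * f n)`. -/
def mulIndex [CharP F p] : Module.End F (quasiPeriodic F p c) where
  toFun f := ⟨fun n => n * (f : ℕ → F) n, fun n => by
    have h : ((n + p : ℕ) : F) = n := by simp
    simp only [f.2 n, h]
    ring⟩
  map_add' f g := by ext n; simp [mul_add]
  map_smul' r f := by ext n; simp [mul_left_comm]

variable (F p c) in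
/-- The operator `f ↦ (n ↦ f (n + 1))`. -/
def shift : Module.End F (quasiPeriodic F p c) where
  toFun f := ⟨fun n => (f : ℕ → F) (n + 1), fun n => by
    simpa only [add_right_comm] using f.2 (n + 1)⟩
  map_add' _ _ := rfl
  map_smul' _ _ := rfl

theorem shift_pow_apply (f : quasiPeriodic F p c) (j n : ℕ) :
    ((shift F p c ^ j) f : ℕ → F) n = (f : ℕ → F) (n + j) := by
  induction j generalizing f with
  | zero => rfl
  | succ j ih => rw [pow_succ, Module.End.mul_apply, ih]; rfl

variable [CharP F p]

theorem mulIndex_pow_apply (f : quasiPeriodic F p c) (i n : ℕ) :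
    ((mulIndex F p c ^ i) f : ℕ → F) n = n ^ i * (f : ℕ → F) n := by
  induction i generalizing f with
  | zero => simp
  | succ i ih =>
    rw [pow_succ, Module.End.mul_apply, ih, pow_succ, mul_assoc]; rfl

theorem isSymbolPair (hp : p.Prime) :
    IsSymbolPair_s8 p 0 c (mulIndex F p c) (shift F p c) where
  pow_sub := by
    have : Fact p.Prime := ⟨hp⟩
    ext f n
    have h : (n : F) ^ p = n := map_natCast (frobenius F p) n
    have := mulIndex_pow_apply f p n
    rw [h] at this
    simpa [sub_eq_zero, mulIndex] using this
  pow_eq := by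
    ext f n
    simpa [shift_pow_apply] using f.2 n
  comm := by
    ext f n
    simp [mulIndex, shift, add_mul]

end quasiPeriodic

namespace SymbolRing

variable {F : Type} [Field F] {p : ℕ}

open quasiPeriodic in
/-- The algebra `[0,c)_{p,F}` is split. -/
theorem nonempty_algEquiv_matrix (hp : p.Prime) [CharP F p] {c : F} (hc : c ≠ 0) :
    Nonempty (SymbolRing F p 0 c ≃ₐ[F] Matrix (Fin p) (Fin p) F) := by
  have : NeZero p := ⟨hp.ne_zero⟩
  let B := Module.Basis.ofEquivFun (equivFun F p c)
  let E := LinearMap.toMatrixAlgEquiv B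
  let φ := lift (isSymbolPair (F := F) (c := c) hp)
  let L := Fintype.linearCombination F (fun ij : Fin p × Fin p =>
    genX F p 0 c ^ (ij.1 : ℕ) * genY F p 0 c ^ (ij.2 : ℕ))
  have hL : Function.Surjective L := by
    rw [← LinearMap.range_eq_top, Fintype.range_linearCombination,
      span_monomials_eq_top hp.one_lt]
  have happ (w : Fin p × Fin p → F) (f : quasiPeriodic F p c) (n : ℕ) :
      (φ (L w) f : ℕ → F) n =
        ∑ i : Fin p, ∑ j : Fin p, w (i, j) * (n ^ (i : ℕ) * (f : ℕ → F) (n + j)) := by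
    simp only [L, Fintype.linearCombination_apply, map_sum, map_smul, map_mul, map_pow, φ,
      lift_genX, lift_genY, Fintype.sum_prod_type, LinearMap.sum_apply, LinearMap.smul_apply,
      Submodule.coe_sum, Finset.sum_apply, Submodule.coe_smul, Pi.smul_apply, smul_eq_mul,
      Module.End.mul_apply, mulIndex_pow_apply, shift_pow_apply]
  have hinj : Function.Injective (φ.toLinearMap ∘ₗ L) := by
    rw [injective_iff_map_eq_zero]
    intro w hw
    ext ⟨i, j⟩
    have hcast : Function.Injective fun n : Fin p => ((n : ℕ) : F) := fun m n h =>
      Fin.ext (CharP.natCast_injOn_Iio F p m.2 n.2 h)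
    refine congrFun (Matrix.eq_zero_of_forall_index_sum_pow_mul_eq_zero (v := fun i => w (i, j))
      hcast fun n => ?_) i
    let f := (equivFun F p c).symm (Pi.single (Fin.ofNat p (n + j)) 1)
    have hf (k : ℕ) : (f : ℕ → F) k =
      c ^ (k / p) * (Pi.single (Fin.ofNat p (n + j)) 1 : Fin p → F) (Fin.ofNat p k) := rfl
    have hf0 (k : Fin p) (hk : k ≠ j) : (f : ℕ → F) (n + k) = 0 := by
      rw [hf, Pi.single_eq_of_ne, mul_zero]
      intro h
      apply hk
      have : (n : ℕ) + k ≡ n + j [MOD p] := congrArg Fin.val h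
      exact Fin.ext (Nat.ModEq.eq_of_lt_of_lt (Nat.ModEq.add_left_cancel' _ this) k.2 j.2)
    have hf1 : (f : ℕ → F) (n + j) ≠ 0 := by
      rw [hf, Pi.single_eq_same, mul_one]
      exact pow_ne_zero _ hc
    have h0 : (φ (L w) f : ℕ → F) n = 0 := by
      have : φ (L w) = 0 := hw
      simp [this]
    rw [happ] at h0
    refine (mul_eq_zero.mp ?_).resolve_right hf1
    rw [← h0, Finset.sum_mul]
    refine Finset.sum_congr rfl fun i _ => ?_
    rw [Finset.sum_eq_single j (fun k _ hk => by rw [hf0 k hk]; simp) (by simp)]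
    ring
  let ψ : SymbolRing F p 0 c →ₐ[F] Matrix (Fin p) (Fin p) F := E.toAlgHom.comp φ
  have hψ : Function.Injective (ψ.toLinearMap ∘ₗ L) := E.injective.comp hinj
  have hdim : Module.finrank F (Fin p × Fin p → F) =
      Module.finrank F (Matrix (Fin p) (Fin p) F) := by
    rw [Module.finrank_matrix]
    simp
  have hψ' := (LinearMap.injective_iff_surjective_of_finrank_eq_finrank hdim).mp hψ
  exact ⟨AlgEquiv.ofBijective ψ ⟨Function.Injective.of_comp_right (f := ψ) (g := L) hψ hL,
    Function.Surjective.of_comp (f := ψ) (g := L) hψ'⟩⟩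

end SymbolRing

theorem Commute.add_pow_prime_of_charP {F A : Type} [Field F] [Ring A] [Algebra F A] {p : ℕ}
    [CharP F p] (hp : p.Prime) {s t : A} (h : Commute s t) : (s + t) ^ p = s ^ p + t ^ p := by
  have : (p : A) = 0 := by
    rw [← map_natCast (algebraMap F A), CharP.cast_eq_zero, map_zero]
  rw [h.add_pow_prime_eq hp, this]
  simp

namespace IsSymbolPair_s8

variable {F A : Type} [Field F] [Ring A] [Algebra F A] {p : ℕ} {a b c : F}

theorem mul_left {x y t : A} (h : IsSymbolPair_s8 p a b x y)
    (ht : t ^ p = algebraMap F A c) (hx : Commute t x) (hy : Commute t y) :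
    IsSymbolPair_s8 p a (c * b) x (t * y) where
  pow_sub := h.pow_sub
  pow_eq := by rw [hy.mul_pow, ht, h.pow_eq, map_mul]
  comm := by rw [mul_assoc, ← hx.left_comm, ← mul_sub, h.comm]

theorem add_left [CharP F p] (hp : p.Prime) {x y t : A} (h : IsSymbolPair_s8 p a b x y)
    (ht : t ^ p - t = algebraMap F A c) (hx : Commute t x) (hy : Commute t y) :
    IsSymbolPair_s8 p (c + a) b (t + x) y where
  pow_sub := by
    rw [hx.add_pow_prime_of_charP (F := F) hp, add_sub_add_comm, ht, h.pow_sub, map_add]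
  pow_eq := h.pow_eq
  comm := by rw [mul_add, add_mul, hy.eq, add_sub_add_left_eq_sub, h.comm]

theorem neg_pow_sub [CharP F p] (hp : p.Prime) {x y : A} (h : IsSymbolPair_s8 p a b x y) :
    (-x) ^ p - (-x) = algebraMap F A (-a) := by
  have := (Commute.neg_left (Commute.refl x)).add_pow_prime_of_charP (F := F) hp
  rw [neg_add_cancel, zero_pow hp.ne_zero, eq_comm, add_eq_zero_iff_eq_neg] at this
  rw [this, map_neg, ← h.pow_sub]
  abel

section Inverse

variable {x y : A}

theorem inv_mul (h : IsSymbolPair_s8 p a b x y) (hp : p ≠ 0) (hb : b ≠ 0) :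
    (b⁻¹ • y ^ (p - 1)) * y = 1 := by
  rw [smul_mul_assoc, pow_sub_one_mul hp, h.pow_eq, Algebra.algebraMap_eq_smul_one,
    inv_smul_smul₀ hb]

theorem mul_inv (h : IsSymbolPair_s8 p a b x y) (hp : p ≠ 0) (hb : b ≠ 0) :
    y * (b⁻¹ • y ^ (p - 1)) = 1 := by
  rw [mul_smul_comm, mul_pow_sub_one hp, h.pow_eq, Algebra.algebraMap_eq_smul_one,
    inv_smul_smul₀ hb]

theorem inv_pow (h : IsSymbolPair_s8 p a b x y) (hp : p ≠ 0) (hb : b ≠ 0) :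
    (b⁻¹ • y ^ (p - 1)) ^ p = algebraMap F A b⁻¹ := by
  rw [smul_pow, ← pow_mul, mul_comm, pow_mul, h.pow_eq, ← map_pow,
    Algebra.algebraMap_eq_smul_one, Algebra.algebraMap_eq_smul_one, smul_smul]
  congr 1
  rw [_root_.inv_pow, inv_mul_eq_iff_eq_mul₀ (pow_ne_zero _ hb), ← pow_sub_one_mul hp b, mul_assoc,
    mul_inv_cancel₀ hb, mul_one]

theorem mul_inv_eq (h : IsSymbolPair_s8 p a b x y) (hp : p ≠ 0) (hb : b ≠ 0) :
    (b⁻¹ • y ^ (p - 1)) * x = (x - 1) * (b⁻¹ • y ^ (p - 1)) := by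
  set t := b⁻¹ • y ^ (p - 1)
  have h₁ : t * y = 1 := h.inv_mul hp hb
  have h₂ : y * t = 1 := h.mul_inv hp hb
  calc t * x = t * (x + 1) * (y * t) - t := by rw [h₂]; noncomm_ring
    _ = t * ((x + 1) * y) * t - t := by noncomm_ring
    _ = (t * y) * x * t - t := by rw [← h.mul_eq]; noncomm_ring
    _ = (x - 1) * t := by rw [h₁]; noncomm_ring

end Inverse

end IsSymbolPair_s8

namespace SymbolRing

variable {F : Type} [Field F] {p : ℕ}

section TensorLift

variable {A : Type} [Ring A] [Algebra F A] {a b a' b' : F} {x y x' y' : A}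

/-- The universal property of `[a,b)_{p,F} ⊗ [a',b')_{p,F}`. -/
noncomputable def tensorLift (h : IsSymbolPair_s8 p a b x y) (h' : IsSymbolPair_s8 p a' b' x' y')
    (hxx : Commute x x') (hxy : Commute x y') (hyx : Commute y x') (hyy : Commute y y') :
    SymbolRing F p a b ⊗[F] SymbolRing F p a' b' →ₐ[F] A :=
  Algebra.TensorProduct.lift (lift h) (lift h') fun s s' => by
    refine commute_of_gen ?_ ?_ s
    · rw [lift_genX]
      exact (commute_of_gen (by simpa using hxx.symm) (by simpa using hxy.symm) s').symm
    · rw [lift_genY]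
      exact (commute_of_gen (by simpa using hyx.symm) (by simpa using hyy.symm) s').symm

theorem tensor_hom_ext {f g : SymbolRing F p a b ⊗[F] SymbolRing F p a' b' →ₐ[F] A}
    (hx : f (genX F p a b ⊗ₜ 1) = g (genX F p a b ⊗ₜ 1))
    (hy : f (genY F p a b ⊗ₜ 1) = g (genY F p a b ⊗ₜ 1))
    (hx' : f (1 ⊗ₜ genX F p a' b') = g (1 ⊗ₜ genX F p a' b'))
    (hy' : f (1 ⊗ₜ genY F p a' b') = g (1 ⊗ₜ genY F p a' b')) : f = g :=
  Algebra.TensorProduct.ext (hom_ext hx hy) (hom_ext hx' hy')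

variable (h : IsSymbolPair_s8 p a b x y) (h' : IsSymbolPair_s8 p a' b' x' y')
    (hxx : Commute x x') (hxy : Commute x y') (hyx : Commute y x') (hyy : Commute y y')

@[simp]
theorem tensorLift_genX_left : tensorLift h h' hxx hxy hyx hyy (genX F p a b ⊗ₜ 1) = x := by
  simp [tensorLift]

@[simp]
theorem tensorLift_genY_left : tensorLift h h' hxx hxy hyx hyy (genY F p a b ⊗ₜ 1) = y := by
  simp [tensorLift]

@[simp]
theorem tensorLift_genX_right : tensorLift h h' hxx hxy hyx hyy (1 ⊗ₜ genX F p a' b') = x' := by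
  simp [tensorLift]

@[simp]
theorem tensorLift_genY_right : tensorLift h h' hxx hxy hyx hyy (1 ⊗ₜ genY F p a' b') = y' := by
  simp [tensorLift]

end TensorLift

/-- If `x₁, y₁` and `x₂, y₂` generate the factors of `[α,β) ⊗ [α,γ)`, then `x₂ - x₁, y₂` and
`x₁, y₁ * y₂` generate commuting copies of `[0,γ)` and `[α,βγ)`. -/
theorem nonempty_tensor_algEquiv [CharP F p] (hp : p.Prime) (α β : F) {γ : F} (hγ : γ ≠ 0) :
    Nonempty ((SymbolRing F p α β ⊗[F] SymbolRing F p α γ) ≃ₐ[F]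
      (SymbolRing F p 0 γ ⊗[F] SymbolRing F p α (β * γ))) := by
  have comm {a b a' b' : F} (s : SymbolRing F p a b) (t : SymbolRing F p a' b') :
      Commute (s ⊗ₜ[F] (1 : SymbolRing F p a' b')) ((1 : SymbolRing F p a b) ⊗ₜ[F] t) := by
    simp [Commute, SemiconjBy]
  have left (a b a' b' : F) : IsSymbolPair_s8 p a b
      (genX F p a b ⊗ₜ[F] (1 : SymbolRing F p a' b')) (genY F p a b ⊗ₜ[F] 1) :=
    (isSymbolPair_gen F p a b).map (Algebra.TensorProduct.includeLeft (R := F) (S := F))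
  have right (a b a' b' : F) : IsSymbolPair_s8 p a' b'
      ((1 : SymbolRing F p a b) ⊗ₜ[F] genX F p a' b') (1 ⊗ₜ[F] genY F p a' b') :=
    have h := (isSymbolPair_gen F p a' b').map
      (Algebra.TensorProduct.includeRight (R := F) (A := SymbolRing F p a b))
    h
  have l₁ := left α β α γ
  have r₁ := right α β α γ
  have l₂ := left 0 γ α (β * γ)
  have r₂ := right 0 γ α (β * γ)
  have cxx₁ := comm (genX F p α β) (genX F p α γ)
  have cxy₁ := comm (genX F p α β) (genY F p α γ)
  have cyx₁ := comm (genY F p α β) (genX F p α γ)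
  have cyy₁ := comm (genY F p α β) (genY F p α γ)
  have cxx₂ := comm (genX F p 0 γ) (genX F p α (β * γ))
  have cxy₂ := comm (genX F p 0 γ) (genY F p α (β * γ))
  have cyx₂ := comm (genY F p 0 γ) (genX F p α (β * γ))
  have cyy₂ := comm (genY F p 0 γ) (genY F p α (β * γ))
  generalize hx₁ : (genX F p α β ⊗ₜ[F] (1 : SymbolRing F p α γ)) = x₁ at *
  generalize hy₁ : (genY F p α β ⊗ₜ[F] (1 : SymbolRing F p α γ)) = y₁ at *
  generalize hx₂ : ((1 : SymbolRing F p α β) ⊗ₜ[F] genX F p α γ) = x₂ at *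
  generalize hy₂ : ((1 : SymbolRing F p α β) ⊗ₜ[F] genY F p α γ) = y₂ at *
  generalize hu : (genX F p 0 γ ⊗ₜ[F] (1 : SymbolRing F p α (β * γ))) = u at *
  generalize hv : (genY F p 0 γ ⊗ₜ[F] (1 : SymbolRing F p α (β * γ))) = v at *
  generalize hx : ((1 : SymbolRing F p 0 γ) ⊗ₜ[F] genX F p α (β * γ)) = x at *
  generalize hy : ((1 : SymbolRing F p 0 γ) ⊗ₜ[F] genY F p α (β * γ)) = y at *
  have hinv {t : SymbolRing F p 0 γ ⊗[F] SymbolRing F p α (β * γ)} (ht : Commute v t) :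
      Commute (γ⁻¹ • v ^ (p - 1)) t := (ht.pow_left _).smul_left _
  have hP₁ : IsSymbolPair_s8 p α β x ((γ⁻¹ • v ^ (p - 1)) * y) := by
    have := r₂.mul_left (l₂.inv_pow hp.ne_zero hγ) (hinv cyx₂) (hinv cyy₂)
    rwa [mul_left_comm, inv_mul_cancel₀ hγ, mul_one] at this
  have hP₂ : IsSymbolPair_s8 p α γ (u + x) v := by
    have := l₂.add_left hp r₂.pow_sub cxx₂.symm cyx₂.symm
    rwa [add_zero, add_comm x] at this
  have hQ₁ : IsSymbolPair_s8 p 0 γ (-x₁ + x₂) y₂ := by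
    have := r₁.add_left hp (l₁.neg_pow_sub hp) cxx₁.neg_left cxy₁.neg_left
    rwa [neg_add_cancel] at this
  have hQ₂ : IsSymbolPair_s8 p α (β * γ) x₁ (y₂ * y₁) := by
    have := l₁.mul_left r₁.pow_eq cxy₁.symm cyy₁.symm
    rwa [mul_comm] at this
  let f := tensorLift hP₁ hP₂ (cxx₂.symm.add_right (Commute.refl x)) cyx₂.symm
    (by
      rw [Commute, SemiconjBy, mul_add, mul_assoc, mul_assoc, ← cxy₂.eq, r₂.mul_eq, ← mul_assoc,
        l₂.mul_inv_eq hp.ne_zero hγ, ← mul_assoc, ((hinv cyx₂).add_right (Commute.one_right _)).eq]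
      generalize γ⁻¹ • v ^ (p - 1) = t
      noncomm_ring)
    ((hinv (Commute.refl v)).mul_left cyy₂.symm)
  let g := tensorLift hQ₁ hQ₂ ((Commute.refl x₁).neg_left.add_left cxx₁.symm)
    (by
      have h₁ := l₁.mul_eq
      have h₂ := r₁.mul_eq
      rw [Commute, SemiconjBy, mul_assoc, mul_add, mul_neg, h₁, cyx₁.eq, mul_add, mul_neg,
        ← mul_assoc y₂ x₂, h₂, add_mul x₁, mul_add, ← mul_assoc y₂ x₁, ← cxy₁.eq]
      noncomm_ring)
    cxy₁.symm ((Commute.refl y₂).mul_right cyy₁.symm)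
  have fx₁ : f x₁ = x := by subst hx₁; exact tensorLift_genX_left ..
  have fy₁ : f y₁ = (γ⁻¹ • v ^ (p - 1)) * y := by subst hy₁; exact tensorLift_genY_left ..
  have fx₂ : f x₂ = u + x := by subst hx₂; exact tensorLift_genX_right ..
  have fy₂ : f y₂ = v := by subst hy₂; exact tensorLift_genY_right ..
  have gu : g u = -x₁ + x₂ := by subst hu; exact tensorLift_genX_left ..
  have gv : g v = y₂ := by subst hv; exact tensorLift_genY_left ..
  have gx : g x = x₁ := by subst hx; exact tensorLift_genX_right ..
  have gy : g y = y₂ * y₁ := by subst hy; exact tensorLift_genY_right ..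
  refine ⟨AlgEquiv.ofAlgHom f g ?_ ?_⟩
  · apply tensor_hom_ext
    · simp [hu, gu, fx₁, fx₂]
    · simp [hv, gv, fy₂]
    · simp [hx, gx, fx₁]
    · simp only [hy, AlgHom.comp_apply, gy, map_mul, fy₁, fy₂, AlgHom.id_apply]
      rw [← mul_assoc, l₂.mul_inv hp.ne_zero hγ, one_mul]
  · apply tensor_hom_ext
    · simp [hx₁, gx, fx₁]
    · simp only [hy₁, AlgHom.comp_apply, fy₁, map_mul, map_smul, map_pow, gv, gy, AlgHom.id_apply]
      rw [← mul_assoc, r₁.inv_mul hp.ne_zero hγ, one_mul]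
    · simp [hx₂, fx₂, gu, gx]
    · simp [hy₂, fy₂, gv]

end SymbolRing

/-- `[α,β) ⊗ [α,γ) ≅ M_p(F) ⊗ [α,βγ)`. -/
theorem symbol_tensor_same_left (p : ℕ) (hp : p.Prime) (F : Type) [Field F] [CharP F p]
    (α β γ : F) (hβ : β ≠ 0) (hγ : γ ≠ 0) :
    Nonempty ((SymbolAlg F p α β ⊗[F] SymbolAlg F p α γ) ≃ₐ[F]
      (Matrix (Fin p) (Fin p) F ⊗[F] SymbolAlg F p α (β * γ))) := by
  obtain ⟨e⟩ := SymbolRing.nonempty_algEquiv_matrix (F := F) hp hγ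
  obtain ⟨e'⟩ := SymbolRing.nonempty_tensor_algEquiv hp α β hγ
  let E (b : F) := SymbolRing.equiv F p α b
  exact ⟨(Algebra.TensorProduct.congr (E β) (E γ)).symm.trans
    (e'.trans (Algebra.TensorProduct.congr e (E (β * γ))))⟩
end
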